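/- Let K be a field of characteristic zero, A = K[x_1,...,x_n], D the basic Weitzenböck derivation (D(x_1)=0, D(x_i)=x_{i-1} for i≥2), and D̂ the derivation with D̂(x_i)=i(n−i)x_{i+1} for i ≤ n−1, D̂(x_n)=0. Let a_1,...,a_k be a system of isobaric generators of the K-subalgebra A_1 = Ker D of A, and for i ≥ 1 set A_i = Ker D^i. Then for every i ≥ 1, A_i is a module over the ring A_1, generated as an A_1-module by the finite set S_i = { D̂^{k_1}(a_{i_1}) · ... · D̂^{k_t}(a_{i_t}) : a_{i_j} ∈ {a_1,...,a_k}, k_j ≥ 0, k_1 + ... + k_t ≤ i−1 } (with the convention D̂^0(a) = 1 as a term, so in particular 1 ∈ S_i). -/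

import Mathlib

open MvPolynomial

section Sl2

variable {K V : Type*} [Field K] [AddCommGroup V] [Module K V] {e f h : V →ₗ[K] V}

theorem LinearMap.iterate_apply_smul (k : ℕ) (c : K) (v : V) : e^[k] (c • v) = c • e^[k] v := by
  rw [← Module.End.pow_apply, ← Module.End.pow_apply, map_smul]

theorem weight_iterate_raise (hhe : ∀ v, h (e v) = e (h v) + (2 : K) • e v)
    {w : K} {v : V} (hv : h v = w • v) (k : ℕ) :
    h (e^[k] v) = (w + 2 * k) • e^[k] v := by
  induction k with
  | zero => simp [hv]
  | succ k ih =>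
    rw [Function.iterate_succ_apply', hhe, ih, map_smul, ← add_smul]
    push_cast
    ring_nf

theorem iterate_raise_lower (hef : ∀ v, e (f v) = f (e v) + h v)
    (hhe : ∀ v, h (e v) = e (h v) + (2 : K) • e v)
    {w : K} {v : V} (hv : h v = w • v) (k : ℕ) :
    e^[k + 1] (f v) = f (e^[k + 1] v) + (((k : K) + 1) * (w + k)) • e^[k] v := by
  induction k with
  | zero => simp [hef, hv]
  | succ k ih =>
    rw [Function.iterate_succ_apply', ih, map_add, map_smul, hef, weight_iterate_raise hhe hv,
      ← Function.iterate_succ_apply' e, ← Function.iterate_succ_apply' e, add_assoc, ← add_smul]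
    congr 2
    push_cast
    ring

theorem iterate_lower_raise (hef : ∀ v, e (f v) = f (e v) + h v)
    (hhf : ∀ v, h (f v) = f (h v) - (2 : K) • f v)
    {w : K} {v : V} (hv : h v = w • v) (k : ℕ) :
    f^[k + 1] (e v) = e (f^[k + 1] v) + (((k : K) + 1) * (k - w)) • f^[k] v := by
  have := iterate_raise_lower (e := f) (f := e) (h := -h) (w := -w) (v := v)
    (fun v => by simp [hef]) (fun v => by simp [hhf, sub_eq_neg_add]) (by simp [hv]) k
  rw [this, neg_add_eq_sub]

theorem iterate_raise_iterate_lower_eq_zero (hef : ∀ v, e (f v) = f (e v) + h v)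
    (hhf : ∀ v, h (f v) = f (h v) - (2 : K) • f v)
    {w : K} {v : V} (hv : h v = w • v) (hev : e v = 0) (k : ℕ) :
    e^[k + 1] (f^[k] v) = 0 := by
  induction k with
  | zero => simpa using hev
  | succ k ih =>
    have hk := iterate_lower_raise hef hhf hv k
    rw [hev, iterate_map_zero] at hk
    rw [Function.iterate_succ_apply, eq_neg_of_add_eq_zero_left hk.symm, iterate_map_neg,
      LinearMap.iterate_apply_smul, ih, smul_zero, neg_zero]

/-- A weight vector killed by `e^(d+1)` lies in the `d`-th step of any filtration that contains
`ker e` and whose index is raised by at most one by the locally nilpotent operator `f`. -/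
theorem mem_filtration_of_iterate_raise_eq_zero [CharZero K]
    (hef : ∀ v, e (f v) = f (e v) + h v)
    (hhe : ∀ v, h (e v) = e (h v) + (2 : K) • e v)
    (hhf : ∀ v, h (f v) = f (h v) - (2 : K) • f v)
    (hnil : ∀ v, ∃ N, f^[N] v = 0)
    {P : ℕ → Submodule K V} (hker : ∀ v, e v = 0 → v ∈ P 0)
    (hmono : ∀ d, P d ≤ P (d + 1)) (hlower : ∀ d, ∀ v ∈ P d, f v ∈ P (d + 1))
    (d : ℕ) : ∀ (w : ℤ) (v : V), h v = (w : K) • v → e^[d + 1] v = 0 → v ∈ P d := by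
  induction d with
  | zero => exact fun w v _ hv => hker v (by simpa using hv)
  | succ d ih =>
    have hweight : ∀ (w : ℤ) (v : V), h v = (w : K) • v → h (e v) = ((w + 2 : ℤ) : K) • e v := by
      intro w v hv
      rw [hhe, hv, map_smul, ← add_smul]
      push_cast
      rfl
    have hfe : ∀ (w : ℤ) (v : V), h v = (w : K) • v → e^[d + 2] v = 0 → f (e v) ∈ P (d + 1) :=
      fun w v hv hev => hlower d _ (ih (w + 2) _ (hweight w v hv) hev)
    have hweight' : ∀ (w : ℤ) (v : V), h v = (w : K) • v → ∀ c : K,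
        h (f (e v) + c • v) = (w : K) • (f (e v) + c • v) := by
      intro w v hv c
      rw [map_add, map_smul, hhf, hweight w v hv, hv, map_smul, ← sub_smul, smul_add,
        smul_comm c]
      push_cast
      rw [add_sub_cancel_right]
    intro w v hv hev
    rcases le_or_gt 0 w with hw | hw
    · have hc : ((d : K) + 1) * (((w + 2 : ℤ) : K) + d) ≠ 0 := by
        have : ((d : ℤ) + 1) * ((w + 2) + d) ≠ 0 := by positivity
        exact_mod_cast this
      have hr : f (e v) + (-(((d : K) + 1) * (((w + 2 : ℤ) : K) + d))) • v ∈ P d := by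
        refine ih w _ (hweight' w v hv _) ?_
        rw [iterate_map_add, LinearMap.iterate_apply_smul,
          iterate_raise_lower hef hhe (hweight w v hv),
          ← Function.iterate_succ_apply e (d + 1), hev, ← Function.iterate_succ_apply e d]
        simp
      have hr' := Submodule.sub_mem _ (hfe w v hv hev) (hmono d hr)
      rw [sub_add_cancel_left, neg_smul, neg_neg] at hr'
      exact (Submodule.smul_mem_iff _ hc).1 hr'
    · obtain ⟨N, hN⟩ := hnil v
      induction N generalizing v with
      | zero => rw [show v = 0 from hN]; exact zero_mem _
      | succ N ihN =>
        have hc : ((N : K) + 1) * (N - w) ≠ 0 := by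
          have : ((N : ℤ) + 1) * (N - w) ≠ 0 := by
            have : 0 < (N : ℤ) - w := by omega
            positivity
          exact_mod_cast this
        have hr : f (e v) + (-(((N : K) + 1) * (N - w))) • v ∈ P (d + 1) := by
          refine ihN _ (hweight' w v hv _) ?_ ?_
          · rw [iterate_map_add, LinearMap.iterate_apply_smul, hev,
              iterate_raise_lower hef hhe (hweight w v hv), ← Function.iterate_succ_apply e,
              ← Function.iterate_succ_apply e, Function.iterate_succ_apply' e, hev]
            simp
          · rw [iterate_map_add, LinearMap.iterate_apply_smul, ← Function.iterate_succ_apply f,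
              iterate_lower_raise hef hhf hv, hN]
            simp
        have hr' := Submodule.sub_mem _ (hfe w v hv hev) hr
        rw [sub_add_cancel_left, neg_smul, neg_neg] at hr'
        exact (Submodule.smul_mem_iff _ hc).1 hr'

theorem Submodule.mem_of_sum_weight_mem [CharZero K] {W : Submodule K V}
    (hW : ∀ v ∈ W, h v ∈ W) (s : Finset ℤ) :
    ∀ g : ℤ → V, (∀ w, h (g w) = (w : K) • g w) → ∑ w ∈ s, g w ∈ W → ∀ w ∈ s, g w ∈ W := by
  induction s using Finset.induction_on with
  | empty => simp
  | insert w₀ s hw₀ ih =>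
    intro g hg hsum
    have key : ∀ w ∈ s, g w ∈ W := by
      intro w hw
      have hmem : ∑ w ∈ s, ((w : K) - w₀) • g w ∈ W := by
        convert W.sub_mem (hW _ hsum) (W.smul_mem (w₀ : K) hsum) using 1
        simp [Finset.sum_insert hw₀, hg, sub_smul, Finset.smul_sum]
      have hne : (w : K) - w₀ ≠ 0 := by
        rw [sub_ne_zero]
        exact_mod_cast (fun h : w = w₀ => hw₀ (h ▸ hw))
      refine (W.smul_mem_iff hne).1 (ih (fun w => ((w : K) - w₀) • g w) (fun w => ?_) hmem w hw)
      rw [map_smul, hg, smul_comm]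
    rw [Finset.sum_insert hw₀] at hsum
    intro w hw
    rcases Finset.mem_insert.1 hw with rfl | hw
    · exact (W.add_mem_iff_left (W.sum_mem key)).1 hsum
    · exact key w hw

end Sl2

section Derivation

variable {R A : Type*} [CommRing R] [CommRing A] [Algebra R A]

theorem Derivation.iterate_mul_eq_zero (D : Derivation R A A) {p q : ℕ} {x y : A}
    (hx : D^[p + 1] x = 0) (hy : D^[q + 1] y = 0) : D^[p + q + 1] (x * y) = 0 := by
  have main : ∀ (r p q : ℕ) (x y : A), p + q ≤ r + 1 → D^[p] x = 0 → D^[q] y = 0 →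
      D^[r] (x * y) = 0 := by
    intro r
    induction r with
    | zero =>
      intro p q x y hpq hx hy
      rcases Nat.eq_zero_or_pos p with rfl | hp
      · simp_all
      · obtain rfl : q = 0 := by omega
        simp_all
    | succ r ih =>
      intro p q x y hpq hx hy
      rcases p with _ | p
      · rw [show x = 0 from hx, zero_mul, iterate_map_zero]
      rcases q with _ | q
      · rw [show y = 0 from hy, mul_zero, iterate_map_zero]
      rw [Function.iterate_succ_apply, D.leibniz, iterate_map_add, smul_eq_mul, smul_eq_mul,
        ih (p + 1) q x (D y) (by omega) hx hy, ih (q + 1) p y (D x) (by omega) hy hx, add_zero]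
  exact main _ _ _ _ _ (by omega) hx hy

theorem Derivation.exists_iterate_eq_zero_of_X {σ : Type*}
    (E : Derivation R (MvPolynomial σ R) (MvPolynomial σ R))
    (hX : ∀ i, ∃ N, E^[N] (X i) = 0) (p : MvPolynomial σ R) : ∃ N, E^[N] p = 0 := by
  induction p using MvPolynomial.induction_on with
  | C r => exact ⟨1, by simp⟩
  | add p q hp hq =>
    obtain ⟨M, hM⟩ := hp
    obtain ⟨N, hN⟩ := hq
    refine ⟨M + N, ?_⟩
    rw [iterate_map_add, Function.iterate_add_apply E M N q, hN, add_comm M,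
      Function.iterate_add_apply, hM, iterate_map_zero, iterate_map_zero, add_zero]
  | mul_X p i hp =>
    obtain ⟨M, hM⟩ := hp
    obtain ⟨N, hN⟩ := hX i
    exact ⟨M + N + 1, E.iterate_mul_eq_zero
      (by rw [Function.iterate_succ_apply', hM, map_zero])
      (by rw [Function.iterate_succ_apply', hN, map_zero])⟩

variable {ι : Type*}

/-- Products of factors `E^k (a l)`, with `k` read as giving the factor `1` when `k = 0`, whose
exponents `k` add up to at most `d`. -/
def derivProducts (E : Derivation R A A) (a : ι → A) (d : ℕ) : Set A :=
  {s | ∃ L : List (ι × ℕ), (L.map Prod.snd).sum ≤ d ∧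
    s = (L.map fun p => if p.2 = 0 then 1 else E^[p.2] (a p.1)).prod}

/-- The linear combinations of `derivProducts E a d` with coefficients in the kernel of `D`. -/
def derivFiltration (D E : Derivation R A A) (a : ι → A) (d : ℕ) : Submodule R A :=
  Submodule.span R {x | ∃ c s, D c = 0 ∧ s ∈ derivProducts E a d ∧ x = c * s}

variable {D E : Derivation R A A} {a : ι → A} {d : ℕ}

theorem mul_mem_derivFiltration {c x : A} (hc : D c = 0) (hx : x ∈ derivFiltration D E a d) :
    c * x ∈ derivFiltration D E a d := by
  induction hx using Submodule.span_induction with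
  | mem x hx =>
    obtain ⟨c', s, hc', hs, rfl⟩ := hx
    exact Submodule.subset_span ⟨c * c', s, by simp [hc, hc'], hs, by ring⟩
  | zero => simp
  | add x y _ _ hx hy => rw [mul_add]; exact add_mem hx hy
  | smul r x _ hx => rw [mul_smul_comm]; exact Submodule.smul_mem _ _ hx

theorem mul_derivProducts_mem_derivFiltration {x s : A} {d' : ℕ}
    (hx : x ∈ derivFiltration D E a d) (hs : s ∈ derivProducts E a d') :
    x * s ∈ derivFiltration D E a (d + d') := by
  induction hx using Submodule.span_induction with
  | mem x hx =>
    obtain ⟨c, _, hc, ⟨L, hL, rfl⟩, rfl⟩ := hx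
    obtain ⟨L', hL', rfl⟩ := hs
    refine Submodule.subset_span ⟨c, _, hc, ⟨L ++ L', ?_, rfl⟩, ?_⟩
    · simp only [List.map_append, List.sum_append]
      omega
    · simp only [List.map_append, List.prod_append, mul_assoc]
  | zero => simp
  | add x y _ _ hx hy => rw [add_mul]; exact add_mem hx hy
  | smul r x _ hx => rw [smul_mul_assoc]; exact Submodule.smul_mem _ _ hx

theorem derivFiltration_mono {d' : ℕ} (h : d ≤ d') :
    derivFiltration D E a d ≤ derivFiltration D E a d' := by
  refine Submodule.span_mono ?_
  rintro _ ⟨c, s, hc, ⟨L, hL, hs⟩, rfl⟩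
  exact ⟨c, s, hc, ⟨L, hL.trans h, hs⟩, rfl⟩

theorem mem_derivFiltration_of_mem_ker {c : A} (hc : D c = 0) : c ∈ derivFiltration D E a d :=
  Submodule.subset_span ⟨c, 1, hc, ⟨[], by simp, by simp⟩, by simp⟩

theorem iterate_mem_derivProducts {k : ℕ} (hk : k ≠ 0) (l : ι) :
    E^[k] (a l) ∈ derivProducts E a k :=
  ⟨[(l, k)], by simp, by simp [hk]⟩

theorem iterate_mem_derivFiltration {k : ℕ} (hk : k ≠ 0) (l : ι) :
    E^[k] (a l) ∈ derivFiltration D E a k :=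
  Submodule.subset_span ⟨1, _, by simp, iterate_mem_derivProducts hk l, by simp⟩

theorem apply_derivProducts_mem {s : A} (hs : s ∈ derivProducts E a d) :
    E s ∈ derivFiltration D E a (d + 1) := by
  obtain ⟨L, hL, rfl⟩ := hs
  induction L generalizing d with
  | nil => simp
  | cons p L ih =>
    obtain ⟨l, k⟩ := p
    simp only [List.map_cons, List.sum_cons] at hL
    simp only [List.map_cons, List.prod_cons]
    rcases eq_or_ne k 0 with rfl | hk
    · simpa using ih (by omega)
    rw [if_neg hk, E.leibniz, smul_eq_mul, smul_eq_mul, mul_comm,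
      mul_comm (List.prod _), ← Function.iterate_succ_apply' E]
    refine add_mem ?_ ?_
    · exact derivFiltration_mono (by omega) (mul_derivProducts_mem_derivFiltration
        (ih (d := d - k) (by omega)) (iterate_mem_derivProducts hk l))
    · exact derivFiltration_mono (by omega) (mul_derivProducts_mem_derivFiltration (d' := d - k)
        (iterate_mem_derivFiltration (Nat.succ_ne_zero k) l) ⟨L, by omega, rfl⟩)

theorem apply_ker_mem_derivFiltration (hgen : ∀ x, x ∈ Algebra.adjoin R (Set.range a) ↔ D x = 0)
    {c : A} (hc : D c = 0) : E c ∈ derivFiltration D E a 1 := by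
  have hc' := (hgen c).2 hc
  induction hc' using Algebra.adjoin_induction with
  | mem x hx =>
    obtain ⟨l, rfl⟩ := hx
    exact iterate_mem_derivFiltration one_ne_zero l
  | algebraMap r => simp
  | add x y hx hy ihx ihy =>
    rw [map_add]
    exact add_mem (ihx ((hgen x).1 hx)) (ihy ((hgen y).1 hy))
  | mul x y hx hy ihx ihy =>
    rw [E.leibniz]
    exact add_mem (mul_mem_derivFiltration ((hgen x).1 hx) (ihy ((hgen y).1 hy)))
      (mul_mem_derivFiltration ((hgen y).1 hy) (ihx ((hgen x).1 hx)))

theorem apply_mem_derivFiltration (hgen : ∀ x, x ∈ Algebra.adjoin R (Set.range a) ↔ D x = 0)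
    {x : A} (hx : x ∈ derivFiltration D E a d) : E x ∈ derivFiltration D E a (d + 1) := by
  induction hx using Submodule.span_induction with
  | mem x hx =>
    obtain ⟨c, s, hc, hs, rfl⟩ := hx
    rw [E.leibniz, smul_eq_mul, smul_eq_mul, mul_comm s]
    refine add_mem (mul_mem_derivFiltration hc (apply_derivProducts_mem hs)) ?_
    rw [add_comm d]
    exact mul_derivProducts_mem_derivFiltration (apply_ker_mem_derivFiltration hgen hc) hs
  | zero => simp
  | add x y _ _ hx hy => rw [map_add]; exact add_mem hx hy
  | smul r x _ hx => rw [E.map_smul]; exact Submodule.smul_mem _ _ hx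

theorem iterate_eq_zero_of_mem_derivProducts (ha : ∀ l k, D^[k + 1] (E^[k] (a l)) = 0)
    {s : A} (hs : s ∈ derivProducts E a d) : D^[d + 1] s = 0 := by
  obtain ⟨L, hL, rfl⟩ := hs
  induction L generalizing d with
  | nil => simp [Function.iterate_succ_apply]
  | cons p L ih =>
    obtain ⟨l, k⟩ := p
    simp only [List.map_cons, List.sum_cons] at hL
    simp only [List.map_cons, List.prod_cons]
    rcases eq_or_ne k 0 with rfl | hk
    · simpa using ih (by omega)
    rw [if_neg hk]
    have := D.iterate_mul_eq_zero (ha l k) (ih (d := d - k) (by omega))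
    rwa [Nat.add_sub_cancel' (by omega)] at this

theorem mem_derivProducts_iff {s : A} : s ∈ derivProducts E a d ↔
    ∃ (t : ℕ) (idx : Fin t → ι) (ks : Fin t → ℕ), (∑ l, ks l) ≤ d ∧
      s = ∏ l, (if ks l = 0 then 1 else E^[ks l] (a (idx l))) := by
  constructor
  · rintro ⟨L, hL, rfl⟩
    refine ⟨L.length, fun l => L[l].1, fun l => L[l].2, ?_, ?_⟩
    · exact (Fin.sum_univ_fun_getElem L Prod.snd).trans_le hL
    · exact (Fin.prod_univ_fun_getElem L
        (fun p => if p.2 = 0 then 1 else E^[p.2] (a p.1))).symm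
  · rintro ⟨t, idx, ks, hks, rfl⟩
    refine ⟨List.ofFn fun l => (idx l, ks l), ?_, ?_⟩
    · simpa [List.map_ofFn, List.sum_ofFn] using hks
    · simp [List.map_ofFn, List.prod_ofFn]

theorem mem_derivFiltration_iff {x : A} : x ∈ derivFiltration D E a d ↔
    ∃ (m : ℕ) (c s : Fin m → A), (∀ j, D (c j) = 0) ∧ (∀ j, s j ∈ derivProducts E a d) ∧
      x = ∑ j, c j * s j := by
  constructor
  · intro hx
    obtain ⟨m, r, g, rfl⟩ := (Submodule.mem_span_set').1 hx
    choose c s hc hs hg using fun j => (g j).2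
    exact ⟨m, fun j => r j • c j, s, fun j => by simp [hc], hs, by simp [hg]⟩
  · rintro ⟨m, c, s, hc, hs, rfl⟩
    exact Submodule.sum_mem _ fun j _ => Submodule.subset_span ⟨c j, s j, hc j, hs j, rfl⟩

end Derivation

section Weights

variable {K σ : Type*} [Field K] {H : Derivation K (MvPolynomial σ K) (MvPolynomial σ K)}

theorem exists_sum_weight_vectors (wt : σ → ℤ) (hX : ∀ i, H (X i) = (wt i : K) • X i)
    (p : MvPolynomial σ K) :
    ∃ (s : Finset ℤ) (g : ℤ → MvPolynomial σ K),
      (∀ w, H (g w) = (w : K) • g w) ∧ p = ∑ w ∈ s, g w := by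
  let U : ℤ → Submodule K (MvPolynomial σ K) := fun w =>
    LinearMap.ker ((H : MvPolynomial σ K →ₗ[K] MvPolynomial σ K) - (w : K) • LinearMap.id)
  have hU : ∀ {w q}, q ∈ U w ↔ H q = (w : K) • q := by simp [U, sub_eq_zero]
  have hp : p ∈ ⨆ w, U w := by
    induction p using MvPolynomial.induction_on with
    | C r => exact Submodule.mem_iSup_of_mem 0 (hU.2 (by simp))
    | add p q hp hq => exact add_mem hp hq
    | mul_X p i hp =>
      induction hp using Submodule.iSup_induction' with
      | mem w q hq =>
        refine Submodule.mem_iSup_of_mem (w + wt i) (hU.2 ?_)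
        rw [H.leibniz, hU.1 hq, hX, smul_eq_mul, smul_eq_mul, mul_smul_comm, mul_smul_comm,
          mul_comm (X i), ← add_smul]
        push_cast
        rw [add_comm]
      | zero => simp
      | add x y _ _ hx hy => rw [add_mul]; exact add_mem hx hy
  obtain ⟨g, hg, rfl⟩ := (Submodule.mem_iSup_iff_exists_finsupp _ _).1 hp
  exact ⟨g.support, g, fun w => hU.1 (hg w), rfl⟩

end Weights

section Weitzenbock

variable {K : Type*} [Field K] {n : ℕ}
  {D Dhat H : Derivation K (MvPolynomial (Fin n) K) (MvPolynomial (Fin n) K)}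

theorem weitzenbock_lie_lower
    (hD_zero : ∀ h : 0 < n, D (X ⟨0, h⟩) = 0)
    (hD_succ : ∀ (i : ℕ) (h : i + 1 < n), D (X ⟨i + 1, h⟩) = X ⟨i, Nat.lt_of_succ_lt h⟩)
    (hDhat : ∀ i : Fin n, Dhat (X i) =
        if h : (i : ℕ) + 1 < n
        then (((i : ℕ) + 1) * (n - ((i : ℕ) + 1)) : K) • X (⟨(i : ℕ) + 1, h⟩ : Fin n)
        else 0)
    (hH : ∀ i : Fin n, H (X i) = ((n : K) - 2 * ((i : ℕ) + 1) + 1) • X i) :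
    ⁅D, Dhat⁆ = H := by
  refine MvPolynomial.derivation_ext fun i => ?_
  obtain ⟨i, hi⟩ := i
  have hn : ¬ i + 1 < n → (n : K) = i + 1 := fun h => by
    rw [show n = i + 1 by omega]
    push_cast
    rfl
  rw [Derivation.commutator_apply, hH, hDhat]
  rcases i with _ | i
  · by_cases h : 0 + 1 < n
    · simp [h, hD_zero, hD_succ]
      ring_nf
    · have := hn h
      simp [h, hD_zero, this]
      norm_num
  · have h' : i + 1 < n := hi
    by_cases h : i + 1 + 1 < n
    · simp [h, h', hD_succ, hDhat, ← sub_smul]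
      ring_nf
    · have := hn h
      simp [h, h', hD_succ, hDhat, this, ← neg_smul]
      ring_nf

theorem weitzenbock_lie_weight_raise
    (hD_zero : ∀ h : 0 < n, D (X ⟨0, h⟩) = 0)
    (hD_succ : ∀ (i : ℕ) (h : i + 1 < n), D (X ⟨i + 1, h⟩) = X ⟨i, Nat.lt_of_succ_lt h⟩)
    (hH : ∀ i : Fin n, H (X i) = ((n : K) - 2 * ((i : ℕ) + 1) + 1) • X i) :
    ⁅H, D⁆ = (2 : K) • D := by
  refine MvPolynomial.derivation_ext fun i => ?_
  obtain ⟨i, hi⟩ := i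
  rw [Derivation.commutator_apply, hH, Derivation.smul_apply, D.map_smul]
  rcases i with _ | i
  · simp [hD_zero]
  · simp [hD_succ, hH, ← sub_smul]
    ring_nf

theorem weitzenbock_lie_weight_lower
    (hDhat : ∀ i : Fin n, Dhat (X i) =
        if h : (i : ℕ) + 1 < n
        then (((i : ℕ) + 1) * (n - ((i : ℕ) + 1)) : K) • X (⟨(i : ℕ) + 1, h⟩ : Fin n)
        else 0)
    (hH : ∀ i : Fin n, H (X i) = ((n : K) - 2 * ((i : ℕ) + 1) + 1) • X i) :
    ⁅H, Dhat⁆ = -(2 : K) • Dhat := by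
  refine MvPolynomial.derivation_ext fun i => ?_
  obtain ⟨i, hi⟩ := i
  rw [Derivation.commutator_apply, hH, Derivation.smul_apply, Dhat.map_smul, hDhat]
  by_cases h : i + 1 < n
  · simp only [h, dite_true, H.map_smul, hH, smul_smul, ← sub_smul]
    push_cast
    ring_nf
  · simp [h]

theorem weitzenbock_lower_nilpotent
    (hDhat : ∀ i : Fin n, Dhat (X i) =
        if h : (i : ℕ) + 1 < n
        then (((i : ℕ) + 1) * (n - ((i : ℕ) + 1)) : K) • X (⟨(i : ℕ) + 1, h⟩ : Fin n)
        else 0)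
    (p : MvPolynomial (Fin n) K) : ∃ N, Dhat^[N] p = 0 := by
  refine Dhat.exists_iterate_eq_zero_of_X (fun i => ⟨n, ?_⟩) p
  have main : ∀ (r : ℕ) (i : Fin n), n ≤ i + r → Dhat^[r] (X i) = 0 := by
    intro r
    induction r with
    | zero => intro i hi; omega
    | succ r ih =>
      intro i hi
      rw [Function.iterate_succ_apply, hDhat]
      split_ifs with h
      · exact (Dhat.toLinearMap.iterate_apply_smul r _ _).trans
          ((congrArg _ (ih _ (by simp only; omega))).trans (smul_zero _))
      · exact iterate_map_zero _ _
  exact main n i (by omega)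

end Weitzenbock


/-- Let `D` be the basic Weitzenböck derivation, `D̂` its opposite `sl_2`-partner and
`a_1,…,a_k` isobaric generators of `A_1 = Ker D` as a `K`-subalgebra. Then for every
`i ≥ 1`, the kernel `A_i = Ker D^i` is generated as an `A_1`-module by the set
`S_i = {D̂^{k_1}(a_{i_1})⋯D̂^{k_t}(a_{i_t}) : Σ k_j ≤ i−1}` (with the convention that a
factor with `k_j = 0` is `1`): `f ∈ A_i` iff `f` is an `A_1`-linear combination of
elements of `S_i`. -/
theorem kernel_powers_generators
    (K : Type*) [Field K] [CharZero K] (n : ℕ)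
    (D Dhat H : Derivation K (MvPolynomial (Fin n) K) (MvPolynomial (Fin n) K))
    (hD : ∀ i : Fin n, D (X i) =
        if h : (i : ℕ) = 0 then 0 else X (⟨(i : ℕ) - 1, by omega⟩ : Fin n))
    (hDhat : ∀ i : Fin n, Dhat (X i) =
        if h : (i : ℕ) + 1 < n
        then (((i : ℕ) + 1) * (n - ((i : ℕ) + 1)) : K) • X (⟨(i : ℕ) + 1, h⟩ : Fin n)
        else 0)
    (hH : ∀ i : Fin n, H (X i) = ((n : K) - 2 * ((i : ℕ) + 1) + 1) • X i)
    (k : ℕ) (a : Fin k → MvPolynomial (Fin n) K)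
    (hiso : ∀ j, ∃ lam : K, H (a j) = lam • a j)
    (hgen : ∀ f : MvPolynomial (Fin n) K,
        f ∈ Algebra.adjoin K (Set.range a) ↔ D f = 0)
    (i : ℕ) (hi : 1 ≤ i) :
    ∀ f : MvPolynomial (Fin n) K,
      (⇑D)^[i] f = 0 ↔
        ∃ (m : ℕ) (c : Fin m → MvPolynomial (Fin n) K)
          (s : Fin m → MvPolynomial (Fin n) K),
          (∀ j, D (c j) = 0) ∧
          (∀ j, ∃ (t : ℕ) (idx : Fin t → Fin k) (ks : Fin t → ℕ),
            (∑ l, ks l) ≤ i - 1 ∧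
            s j = ∏ l, (if ks l = 0 then 1 else (⇑Dhat)^[ks l] (a (idx l)))) ∧
          f = ∑ j, c j * s j := by
  obtain ⟨d, rfl⟩ : ∃ d, i = d + 1 := ⟨i - 1, by omega⟩
  have hD_zero : ∀ h : 0 < n, D (X ⟨0, h⟩) = 0 := fun h => by simp [hD]
  have hD_succ : ∀ (i : ℕ) (h : i + 1 < n), D (X ⟨i + 1, h⟩) = X ⟨i, Nat.lt_of_succ_lt h⟩ :=
    fun i h => by simp [hD]
  have hef : ∀ v, D (Dhat v) = Dhat (D v) + H v := fun v => by
    rw [← weitzenbock_lie_lower hD_zero hD_succ hDhat hH, Derivation.commutator_apply, add_sub_cancel]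
  have hhe : ∀ v, H (D v) = D (H v) + (2 : K) • D v := fun v => by
    rw [← Derivation.smul_apply, ← weitzenbock_lie_weight_raise hD_zero hD_succ hH,
      Derivation.commutator_apply, add_sub_cancel]
  have hhf : ∀ v, H (Dhat v) = Dhat (H v) - (2 : K) • Dhat v := fun v => by
    rw [sub_eq_add_neg, ← neg_smul, ← Derivation.smul_apply,
      ← weitzenbock_lie_weight_lower hDhat hH, Derivation.commutator_apply, add_sub_cancel]
  have ha : ∀ l k, D^[k + 1] (Dhat^[k] (a l)) = 0 := fun l k => by
    obtain ⟨w, hw⟩ := hiso l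
    exact iterate_raise_iterate_lower_eq_zero (e := D.toLinearMap) (f := Dhat.toLinearMap)
      (h := H.toLinearMap) hef hhf hw
      ((hgen _).1 (Algebra.subset_adjoin (Set.mem_range_self l))) k
  intro p
  simp only [Nat.add_sub_cancel, ← mem_derivProducts_iff]
  rw [← mem_derivFiltration_iff]
  let W : Submodule K (MvPolynomial (Fin n) K) := LinearMap.ker (D.toLinearMap ^ (d + 1))
  have hW : ∀ {q}, q ∈ W ↔ D^[d + 1] q = 0 := fun {q} => by
    rw [LinearMap.mem_ker, Module.End.pow_apply]
    rfl
  constructor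
  · intro hp
    obtain ⟨s, g, hg, rfl⟩ := exists_sum_weight_vectors (fun i : Fin n => (n : ℤ) - 2 * (i + 1) + 1)
      (by simpa using hH) p
    have hinv : ∀ q ∈ W, H q ∈ W := by
      have hcomm : ∀ (r : ℕ) q, D^[r] (H q) = H (D^[r] q) - (2 * r : K) • D^[r] q := by
        intro r q
        induction r with
        | zero => simp
        | succ r ih =>
          rw [Function.iterate_succ_apply', ih, map_sub, D.map_smul,
            ← Function.iterate_succ_apply' D, Function.iterate_succ_apply' D r q, hhe]
          push_cast
          module
      intro q hq
      rw [hW] at hq ⊢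
      rw [hcomm, hq, map_zero, smul_zero, sub_zero]
    refine Submodule.sum_mem _ fun w hw => ?_
    have hgw := Submodule.mem_of_sum_weight_mem (h := H.toLinearMap) hinv s g hg (hW.2 hp) w hw
    exact mem_filtration_of_iterate_raise_eq_zero (e := D.toLinearMap) (f := Dhat.toLinearMap)
      (h := H.toLinearMap) hef hhe hhf (weitzenbock_lower_nilpotent hDhat)
      (P := derivFiltration D Dhat a) (fun _ => mem_derivFiltration_of_mem_ker)
      (fun d => derivFiltration_mono d.le_succ) (fun _ _ => apply_mem_derivFiltration hgen)
      d w (g w) (hg w) (hW.1 hgw)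
  · rw [mem_derivFiltration_iff]
    rintro ⟨m, c, s, hc, hs, rfl⟩
    refine hW.1 (W.sum_mem fun j _ => hW.2 ?_)
    have := D.iterate_mul_eq_zero (p := 0) (hc j) (iterate_eq_zero_of_mem_derivProducts ha (hs j))
    rwa [zero_add] at this
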